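/- arXiv:2201.02701 — 3 statements merged into one kernel-verified Lean document; each statement's English description precedes it below -/
import Mathlib

section
/- Let (P, 𝓛) be a linear space containing no O'Nan configuration, let q ≥ 2 be an integer, let (U, 𝓑) be a unital of order q, and let (α, β) be an embedding of (U, 𝓑) into (P, 𝓛). If two blocks B₁, B₂ ∈ 𝓑 have no point of U in common, then the blocks β(B₁) and β(B₂) of (P, 𝓛) are disjoint. -/
/-- A linear space: every block has at least two points, and any two distinct
points lie on exactly one block. -/
def IsLinearSpace {P : Type*} (L : Set (Set P)) : Prop :=
  (∀ B ∈ L, Set.Nontrivial B) ∧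
    ∀ x y : P, x ≠ y → ∃! B, B ∈ L ∧ x ∈ B ∧ y ∈ B

/-- A unital of order `q`: a linear space with `q³ + 1` points all of whose
blocks have exactly `q + 1` points. -/
def IsUnital (U : Type*) (B : Set (Set U)) (q : ℕ) : Prop :=
  IsLinearSpace B ∧ Nat.card U = q ^ 3 + 1 ∧ ∀ b ∈ B, Set.ncard b = q + 1

/-- An O'Nan configuration with points taken from `H`: four distinct blocks and six
distinct points, each block containing exactly three of the points and each point
lying on exactly two of the blocks. -/
def HasONanConfig {P : Type*} (H : Set P) (L : Set (Set P)) : Prop :=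
  ∃ (B : Fin 4 → Set P) (p : Fin 6 → P),
    Function.Injective B ∧ Function.Injective p ∧
    (∀ i, B i ∈ L) ∧ (∀ j, p j ∈ H) ∧
    (∀ i, Nat.card {j : Fin 6 // p j ∈ B i} = 3) ∧
    (∀ j, Nat.card {i : Fin 4 // p j ∈ B i} = 2)

theorem IsLinearSpace.eq_of_mem {P : Type*} {L : Set (Set P)} (hL : IsLinearSpace L)
    {B C : Set P} (hB : B ∈ L) (hC : C ∈ L) {x y : P} (hxy : x ≠ y)
    (hxB : x ∈ B) (hyB : y ∈ B) (hxC : x ∈ C) (hyC : y ∈ C) : B = C :=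
  (hL.2 x y hxy).unique ⟨hB, hxB, hyB⟩ ⟨hC, hxC, hyC⟩

/-- Four pairwise intersecting blocks, no three of which are concurrent, form an
O'Nan configuration. -/
theorem hasONanConfig_of_mem {P : Type*} {L : Set (Set P)} {A B C D : Set P}
    (hA : A ∈ L) (hB : B ∈ L) (hC : C ∈ L) (hD : D ∈ L) {ab ac ad bc bd cd : P}
    (hab : ab ∈ A ∧ ab ∈ B ∧ ab ∉ C ∧ ab ∉ D)
    (hac : ac ∈ A ∧ ac ∉ B ∧ ac ∈ C ∧ ac ∉ D)
    (had : ad ∈ A ∧ ad ∉ B ∧ ad ∉ C ∧ ad ∈ D)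
    (hbc : bc ∉ A ∧ bc ∈ B ∧ bc ∈ C ∧ bc ∉ D)
    (hbd : bd ∉ A ∧ bd ∈ B ∧ bd ∉ C ∧ bd ∈ D)
    (hcd : cd ∉ A ∧ cd ∉ B ∧ cd ∈ C ∧ cd ∈ D) :
    HasONanConfig (Set.univ : Set P) L := by
  classical
  obtain ⟨hab₁, hab₂, hab₃, hab₄⟩ := hab
  obtain ⟨hac₁, hac₂, hac₃, hac₄⟩ := hac
  obtain ⟨had₁, had₂, had₃, had₄⟩ := had
  obtain ⟨hbc₁, hbc₂, hbc₃, hbc₄⟩ := hbc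
  obtain ⟨hbd₁, hbd₂, hbd₃, hbd₄⟩ := hbd
  obtain ⟨hcd₁, hcd₂, hcd₃, hcd₄⟩ := hcd
  refine ⟨![A, B, C, D], ![ab, ac, ad, bc, bd, cd], ?_, ?_, ?_, fun _ => trivial, ?_, ?_⟩
  · intro i j h
    fin_cases i <;> fin_cases j <;> simp at h ⊢ <;> subst h <;> contradiction
  · intro i j h
    fin_cases i <;> fin_cases j <;> simp at h ⊢ <;> subst h <;> contradiction
  · intro i
    fin_cases i <;> assumption
  · intro i
    rw [Nat.card_eq_fintype_card, Fintype.card_subtype, Finset.card_filter]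
    fin_cases i <;> simp [Fin.sum_univ_six, -Finset.sum_boole, *]
  · intro j
    rw [Nat.card_eq_fintype_card, Fintype.card_subtype, Finset.card_filter]
    fin_cases j <;> simp [Fin.sum_univ_four, -Finset.sum_boole, *]

/-- If a unital of order `q` is embedded in a linear space without O'Nan
configurations, then disjoint blocks of the unital have disjoint images. -/
theorem disjoint_blocks_have_disjoint_images
    {U P : Type*} {𝓑 : Set (Set U)} {𝓛 : Set (Set P)} {q : ℕ} (hq : 2 ≤ q)
    (hP : IsLinearSpace 𝓛) (hNoONan : ¬ HasONanConfig (Set.univ : Set P) 𝓛)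
    (hU : IsUnital U 𝓑 q)
    (α : U → P) (β : Set U → Set P)
    (hα : Function.Injective α)
    (hβmem : ∀ B ∈ 𝓑, β B ∈ 𝓛)
    (hβinj : Set.InjOn β 𝓑)
    (hinc : ∀ (x : U), ∀ B ∈ 𝓑, (x ∈ B ↔ α x ∈ β B))
    {B₁ B₂ : Set U} (h1 : B₁ ∈ 𝓑) (h2 : B₂ ∈ 𝓑) (hdisj : B₁ ∩ B₂ = ∅) :
    β B₁ ∩ β B₂ = ∅ := by
  classical
  obtain ⟨hUlin, hcard, hsize⟩ := hU
  have : Finite U := Nat.finite_of_card_ne_zero (by omega)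
  have : Fintype U := Fintype.ofFinite U
  by_contra hne
  obtain ⟨z, hz1, hz2⟩ := Set.nonempty_iff_ne_empty.mpr hne
  have hd : ∀ x, x ∈ B₁ → x ∈ B₂ → False := fun x hx hy => by
    have : x ∈ B₁ ∩ B₂ := ⟨hx, hy⟩
    simp [hdisj] at this
  have hz : ∀ x, α x ≠ z := fun x hx =>
    hd x ((hinc x _ h1).2 (hx ▸ hz1)) ((hinc x _ h2).2 (hx ▸ hz2))
  -- a block of the unital passing through `z` equals any other such block that it meets
  have hzB : ∀ B ∈ 𝓑, ∀ C ∈ 𝓑, z ∈ β B → z ∈ β C → ∀ x, x ∈ B → x ∈ C → B = C :=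
    fun B hB C hC hzB hzC x hxB hxC => hβinj hB hC <|
      hP.eq_of_mem (hβmem B hB) (hβmem C hC) (hz x) ((hinc x B hB).1 hxB) hzB
        ((hinc x C hC).1 hxC) hzC
  have hjoin : ∀ p : U × U, ∃ B : Set U, p.1 ∈ B₁ → p.2 ∈ B₂ → B ∈ 𝓑 ∧ p.1 ∈ B ∧ p.2 ∈ B := by
    intro p
    by_cases h : p.1 = p.2
    · exact ⟨∅, fun ha hb => (hd _ ha (h ▸ hb)).elim⟩
    · obtain ⟨B, hB, -⟩ := hUlin.2 _ _ h
      exact ⟨B, fun _ _ => hB⟩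
  choose ℓ hℓ using hjoin
  -- transversals meet `B₁` and `B₂` only in the points they join
  have hℓ1 : ∀ p : U × U, p.1 ∈ B₁ → p.2 ∈ B₂ → ∀ x ∈ ℓ p, x ∈ B₁ → x = p.1 := by
    intro p ha hb x hx hx1
    obtain ⟨hm, hpa, hpb⟩ := hℓ p ha hb
    by_contra hxa
    have := hUlin.eq_of_mem hm h1 hxa hx hpa hx1 ha
    exact hd _ (this ▸ hpb) hb
  have hℓ2 : ∀ p : U × U, p.1 ∈ B₁ → p.2 ∈ B₂ → ∀ x ∈ ℓ p, x ∈ B₂ → x = p.2 := by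
    intro p ha hb x hx hx2
    obtain ⟨hm, hpa, hpb⟩ := hℓ p ha hb
    by_contra hxb
    have := hUlin.eq_of_mem hm h2 hxb hx hpb hx2 hb
    exact hd _ ha (this ▸ hpa)
  have hzℓ : ∀ p : U × U, p.1 ∈ B₁ → p.2 ∈ B₂ → z ∉ β (ℓ p) := by
    intro p ha hb hzp
    obtain ⟨hm, hpa, hpb⟩ := hℓ p ha hb
    have := hzB _ hm _ h1 hzp hz1 _ hpa ha
    exact hd _ (this ▸ hpb) hb
  let S := B₁.toFinset ×ˢ B₂.toFinset
  have hS : ∀ p, p ∈ S ↔ p.1 ∈ B₁ ∧ p.2 ∈ B₂ := by simp [S]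
  let T : U × U → Finset U := fun p => (ℓ p).toFinset \ {p.1, p.2}
  have hT : ∀ p x, x ∈ T p ↔ x ∈ ℓ p ∧ x ≠ p.1 ∧ x ≠ p.2 := by simp [T]
  have hpair : ∀ p ∈ S, ∀ p' ∈ S, p ≠ p' → Disjoint (T p) (T p') := by
    intro p hp p' hp' hpp'
    rw [Finset.disjoint_left]
    intro w hw hw'
    rw [hS] at hp hp'
    rw [hT] at hw hw'
    obtain ⟨ha, hb⟩ := hp
    obtain ⟨ha', hb'⟩ := hp'
    obtain ⟨hwp, hwa, hwb⟩ := hw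
    obtain ⟨hwp', hwa', hwb'⟩ := hw'
    obtain ⟨hm, hpa, hpb⟩ := hℓ p ha hb
    obtain ⟨hm', hpa', hpb'⟩ := hℓ p' ha' hb'
    have hlines : ℓ p ≠ ℓ p' := fun h => hpp' <| Prod.ext
      (hℓ1 p' ha' hb' _ (h ▸ hpa) ha) (hℓ2 p' ha' hb' _ (h ▸ hpb) hb)
    have hmeet : ∀ x, x ≠ w → x ∈ ℓ p → x ∉ ℓ p' := fun x hxw hx hx' =>
      hlines (hUlin.eq_of_mem hm hm' hxw hx hwp hx' hwp')
    refine hNoONan (hasONanConfig_of_mem (hβmem _ h1) (hβmem _ h2) (hβmem _ hm) (hβmem _ hm')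
      (ab := z) (ac := α p.1) (ad := α p'.1) (bc := α p.2) (bd := α p'.2) (cd := α w)
      ⟨hz1, hz2, hzℓ p ha hb, hzℓ p' ha' hb'⟩ ?_ ?_ ?_ ?_ ?_)
    all_goals simp only [← hinc _ _ h1, ← hinc _ _ h2, ← hinc _ _ hm, ← hinc _ _ hm']
    · exact ⟨ha, fun h => hd _ ha h, hpa, hmeet _ hwa.symm hpa⟩
    · exact ⟨ha', fun h => hd _ ha' h, fun h => hmeet _ hwa'.symm h hpa', hpa'⟩
    · exact ⟨fun h => hd _ h hb, hb, hpb, hmeet _ hwb.symm hpb⟩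
    · exact ⟨fun h => hd _ h hb', hb', fun h => hmeet _ hwb'.symm h hpb', hpb'⟩
    · exact ⟨fun h => hwa (hℓ1 p ha hb w hwp h), fun h => hwb (hℓ2 p ha hb w hwp h), hwp, hwp'⟩
  have hsize' : ∀ B ∈ 𝓑, B.toFinset.card = q + 1 := fun B hB => by
    rw [← Set.ncard_eq_toFinset_card', hsize B hB]
  have hTcard : ∀ p ∈ S, (T p).card = q - 1 := by
    intro p hp
    obtain ⟨ha, hb⟩ := (hS p).1 hp
    obtain ⟨hm, hpa, hpb⟩ := hℓ p ha hb
    have hne : p.1 ≠ p.2 := fun h => hd _ ha (h ▸ hb)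
    rw [Finset.card_sdiff_of_subset (by simp [Set.insert_subset_iff, hpa, hpb]),
      hsize' _ hm, Finset.card_pair hne]
    omega
  have hcount : (S.biUnion T).card = (q + 1) * (q + 1) * (q - 1) := by
    rw [Finset.card_biUnion hpair, Finset.sum_congr rfl hTcard, Finset.sum_const, smul_eq_mul,
      Finset.card_product, hsize' _ h1, hsize' _ h2]
  have hdisjoint : Disjoint (S.biUnion T) B₁.toFinset := by
    rw [Finset.disjoint_left]
    intro w hw hw1
    obtain ⟨p, hp, hwp⟩ := Finset.mem_biUnion.1 hw
    obtain ⟨ha, hb⟩ := (hS p).1 hp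
    obtain ⟨hwp, hwa, -⟩ := (hT p w).1 hwp
    exact hwa (hℓ1 p ha hb w hwp (Set.mem_toFinset.1 hw1))
  have hle := Finset.card_le_univ (S.biUnion T ∪ B₁.toFinset)
  rw [Finset.card_union_of_disjoint hdisjoint, hcount, hsize' _ h1, ← Nat.card_eq_fintype_card,
    hcard] at hle
  obtain ⟨r, rfl⟩ := Nat.exists_eq_add_of_le' hq
  simp only [show r + 2 - 1 = r + 1 by omega] at hle
  nlinarith
end

section
/- For any block B of the generalized hermitian unital H(C|R) and any three distinct points x, y, z ∈ B, there exists a translation of H(C|R) with center z mapping x to y. -/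
noncomputable section

/-- A line of the projective plane `PG(2,C)`: the zero set of a nonzero linear form. -/
def IsLine (C : Type*) [Field C] (ℓ : Set (Projectivization C (Fin 3 → C))) : Prop :=
  ∃ f : (Fin 3 → C) →ₗ[C] C, f ≠ 0 ∧ ℓ = {P : Projectivization C (Fin 3 → C) | f P.rep = 0}

/-- The point set of the generalized hermitian unital `H(C|R)`:
points `[X,Y,Z]` with `σ(X)·Y + σ(Z)·Z ∈ εR`. -/
def hermSet {C : Type*} [Field C] (R : Subfield C) (σ : C →+* C) (ε : C) :
    Set (Projectivization C (Fin 3 → C)) :=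
  {P | ∃ v : Fin 3 → C, ∃ hv : v ≠ 0, P = Projectivization.mk C v hv ∧
        ∃ r ∈ R, σ (v 0) * v 1 + σ (v 2) * v 2 = ε * r}

/-- A block of `H(C|R)`: the trace of a line meeting the point set in at least two points. -/
def IsHermBlock {C : Type*} [Field C] (R : Subfield C) (σ : C →+* C) (ε : C)
    (B : Set (Projectivization C (Fin 3 → C))) : Prop :=
  ∃ ℓ, IsLine C ℓ ∧ (hermSet R σ ε ∩ ℓ).Nontrivial ∧ B = hermSet R σ ε ∩ ℓ

/-- An automorphism of the incidence structure `(H, Bl)`: a bijection of `H`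
mapping blocks onto blocks. -/
def IsUnitalAuto {P : Type*} (H : Set P) (Bl : Set P → Prop) (φ : P → P) : Prop :=
  Set.BijOn φ H H ∧ (∀ B, Bl B → Bl (φ '' B)) ∧ (∀ B, Bl B → ∃ B', Bl B' ∧ φ '' B' = B)

/-- A translation with center `z`: an automorphism fixing `z` and mapping each
block through `z` onto itself. -/
def IsTranslation {P : Type*} (H : Set P) (Bl : Set P → Prop) (z : P) (φ : P → P) : Prop :=
  IsUnitalAuto H Bl φ ∧ φ z = z ∧ ∀ B, Bl B → z ∈ B → φ '' B = B

open Projectivization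

section Collineation

variable {C : Type*} [Field C]

lemma dual_rep_mk_eq_zero_iff (f : (Fin 3 → C) →ₗ[C] C) (v : Fin 3 → C) (hv : v ≠ 0) :
    f (Projectivization.mk C v hv).rep = 0 ↔ f v = 0 := by
  obtain ⟨a, ha⟩ := exists_smul_eq_mk_rep C v hv
  rw [← ha, Units.smul_def, map_smul, smul_eq_mul, mul_eq_zero]
  simp

/-- The collineation of `PG(2,C)` induced by a linear automorphism of `C³`. -/
def collineation (e : (Fin 3 → C) ≃ₗ[C] (Fin 3 → C)) :
    Projectivization C (Fin 3 → C) → Projectivization C (Fin 3 → C) :=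
  Projectivization.map e.toLinearMap e.injective

lemma collineation_mk (e : (Fin 3 → C) ≃ₗ[C] (Fin 3 → C)) (v : Fin 3 → C) (hv : v ≠ 0) :
    collineation e (Projectivization.mk C v hv)
      = Projectivization.mk C (e v) (e.map_ne_zero_iff.2 hv) := rfl

lemma collineation_bijective (e : (Fin 3 → C) ≃ₗ[C] (Fin 3 → C)) :
    Function.Bijective (collineation e) := by
  refine ⟨Projectivization.map_injective _ _, fun P => ?_⟩
  induction P using Projectivization.ind with | h v hv =>
  refine ⟨Projectivization.mk C (e.symm v) (e.symm.map_ne_zero_iff.2 hv), ?_⟩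
  simp [collineation_mk]

lemma collineation_preimage_line (e : (Fin 3 → C) ≃ₗ[C] (Fin 3 → C))
    (f : (Fin 3 → C) →ₗ[C] C) :
    collineation e ⁻¹' {P | f P.rep = 0} = {P | (f ∘ₗ e.toLinearMap) P.rep = 0} := by
  ext P
  induction P using Projectivization.ind with | h v hv =>
  simp only [Set.mem_preimage, Set.mem_ofPred_eq, collineation_mk, dual_rep_mk_eq_zero_iff]
  rfl

lemma IsLine.collineation_preimage {ℓ : Set (Projectivization C (Fin 3 → C))} (hℓ : IsLine C ℓ)
    (e : (Fin 3 → C) ≃ₗ[C] (Fin 3 → C)) : IsLine C (collineation e ⁻¹' ℓ) := by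
  obtain ⟨f, hf, rfl⟩ := hℓ
  refine ⟨f ∘ₗ e.toLinearMap, fun h => hf ?_, collineation_preimage_line e f⟩
  ext1 i
  ext
  simpa using LinearMap.congr_fun h (e.symm (Pi.single i 1))

lemma IsLine.collineation_image {ℓ : Set (Projectivization C (Fin 3 → C))} (hℓ : IsLine C ℓ)
    (e : (Fin 3 → C) ≃ₗ[C] (Fin 3 → C)) : IsLine C (collineation e '' ℓ) := by
  convert hℓ.collineation_preimage e.symm using 1
  refine congrFun (Set.image_eq_preimage_of_inverse (fun P => ?_) (fun P => ?_)) ℓ <;>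
  · induction P using Projectivization.ind with | h v hv =>
    simp [collineation_mk]

variable {R : Subfield C} {σ : C →+* C} {ε : C}

lemma collineation_isUnitalAuto (e : (Fin 3 → C) ≃ₗ[C] (Fin 3 → C))
    (he : collineation e ⁻¹' hermSet R σ ε = hermSet R σ ε) :
    IsUnitalAuto (hermSet R σ ε) (IsHermBlock R σ ε) (collineation e) := by
  have hbij := collineation_bijective e
  have him : collineation e '' hermSet R σ ε = hermSet R σ ε := by
    conv_lhs => rw [← he]
    exact Set.image_preimage_eq _ hbij.2
  refine ⟨?_, ?_, ?_⟩
  · have := (hbij.1.injOn (s := hermSet R σ ε)).bijOn_image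
    rwa [him] at this
  · rintro _ ⟨ℓ, hℓ, hn, rfl⟩
    have h : collineation e '' (hermSet R σ ε ∩ ℓ)
        = hermSet R σ ε ∩ collineation e '' ℓ := by
      rw [Set.image_inter hbij.1, him]
    exact ⟨_, hℓ.collineation_image e, h ▸ hn.image hbij.1, h⟩
  · rintro _ ⟨ℓ, hℓ, hn, rfl⟩
    have h : collineation e ⁻¹' (hermSet R σ ε ∩ ℓ)
        = hermSet R σ ε ∩ collineation e ⁻¹' ℓ := by
      rw [Set.preimage_inter, he]
    exact ⟨_, ⟨_, hℓ.collineation_preimage e, h ▸ hn.preimage hbij.2, h⟩,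
      Set.image_preimage_eq _ hbij.2⟩

end Collineation

section QuadraticExtension

variable {C : Type*} [Field C]

/-- `C = R + εR` is quadratic over `R`, with `ε² - tε + d = 0`, and `σ` is the generator of
`Aut_R(C)`. -/
structure IsQuadraticPair (R : Subfield C) (ε t d : C) (σ : C →+* C) : Prop where
  not_mem : ε ∉ R
  trace_mem : t ∈ R
  norm_mem : d ∈ R
  sq_eq : ε ^ 2 = t * ε - d
  map_of_mem : ∀ r ∈ R, σ r = r
  map_gen : σ ε = t - ε
  exists_eq : ∀ c : C, ∃ a ∈ R, ∃ b ∈ R, c = a + b * ε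

/-- The set `εR`. -/
def genMultiples (R : Subfield C) (ε : C) : Submodule R C := Submodule.span R {ε}

/-- The form `σ(X)·Y + σ(Z)·Z`. -/
def hermForm (σ : C →+* C) (v : Fin 3 → C) : C := σ (v 0) * v 1 + σ (v 2) * v 2

/-- The linear form defining the tangent line at the point represented by `u`. -/
def tangentForm (σ : C →+* C) (ε d : C) (u : Fin 3 → C) : (Fin 3 → C) →ₗ[C] C :=
  (d * σ (u 0)) • LinearMap.proj 1 - (ε ^ 2 * σ (u 1)) • LinearMap.proj 0
    + ((d - ε ^ 2) * σ (u 2)) • LinearMap.proj 2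

lemma tangentForm_apply (σ : C →+* C) (ε d : C) (u v : Fin 3 → C) :
    tangentForm σ ε d u v
      = d * σ (u 0) * v 1 - ε ^ 2 * σ (u 1) * v 0 + (d - ε ^ 2) * σ (u 2) * v 2 := by
  simp [tangentForm]

lemma isQuadraticPair_of_finrank (R : Subfield C) (ε t d : C) (σ : C →+* C)
    (hrank : Module.finrank R C = 2)
    (hε : ε ∉ R) (ht : t ∈ R) (hd : d ∈ R) (hmin : ε ^ 2 - t * ε + d = 0)
    (hσR : ∀ r ∈ R, σ r = r) (hσε : σ ε = t - ε) : IsQuadraticPair R ε t d σ := by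
  refine ⟨hε, ht, hd, by linear_combination hmin, hσR, hσε, fun c => ?_⟩
  have hli : LinearIndependent R ![(1 : C), ε] := by
    rw [LinearIndependent.pair_iff' one_ne_zero]
    rintro a rfl
    exact hε (by simp [Subfield.smul_def])
  have htop := hli.span_eq_top_of_card_eq_finrank (by simp [hrank])
  have hc : c ∈ Submodule.span R (Set.range ![(1 : C), ε]) := htop ▸ Submodule.mem_top
  rw [Matrix.range_cons_cons_empty, Submodule.mem_span_pair] at hc
  obtain ⟨a, b, rfl⟩ := hc
  exact ⟨a, a.2, b, b.2, by simp [Subfield.smul_def]⟩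

variable {R : Subfield C} {ε t d : C} {σ : C →+* C}

lemma mem_genMultiples {w : C} : w ∈ genMultiples R ε ↔ ∃ r ∈ R, w = ε * r := by
  rw [genMultiples, Submodule.mem_span_singleton]
  constructor
  · rintro ⟨a, rfl⟩
    exact ⟨a, a.2, by rw [Subfield.smul_def, smul_eq_mul, mul_comm]⟩
  · rintro ⟨r, hr, rfl⟩
    exact ⟨⟨r, hr⟩, by rw [Subfield.smul_def, smul_eq_mul, mul_comm]⟩

lemma mul_mem_genMultiples {r w : C} (hr : r ∈ R) (hw : w ∈ genMultiples R ε) :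
    r * w ∈ genMultiples R ε :=
  (genMultiples R ε).smul_mem ⟨r, hr⟩ hw

lemma mul_mem_genMultiples_iff {r w : C} (hr : r ∈ R) (hr0 : r ≠ 0) :
    r * w ∈ genMultiples R ε ↔ w ∈ genMultiples R ε := by
  refine ⟨fun h => ?_, mul_mem_genMultiples hr⟩
  simpa [hr0] using mul_mem_genMultiples (R.inv_mem hr) h

namespace IsQuadraticPair

variable (h : IsQuadraticPair R ε t d σ)
include h

lemma gen_ne_zero : ε ≠ 0 := by
  rintro rfl
  exact h.not_mem R.zero_mem

lemma norm_ne_zero : d ≠ 0 := by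
  intro hd
  have h1 : ε * (t - ε) = 0 := by linear_combination -h.sq_eq + hd
  rcases mul_eq_zero.1 h1 with h0 | h0
  · exact h.gen_ne_zero h0
  · exact h.not_mem (sub_eq_zero.1 h0 ▸ h.trace_mem)

lemma map_map (c : C) : σ (σ c) = c := by
  obtain ⟨a, ha, b, hb, rfl⟩ := h.exists_eq c
  simp [h.map_of_mem _ ha, h.map_of_mem _ hb, h.map_gen, h.map_of_mem _ h.trace_mem]

lemma map_mul_self_mem (c : C) : σ c * c ∈ R := by
  obtain ⟨a, ha, b, hb, rfl⟩ := h.exists_eq c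
  have : σ (a + b * ε) * (a + b * ε) = a * a + a * b * t + b * b * d := by
    simp only [map_add, map_mul, h.map_of_mem _ ha, h.map_of_mem _ hb, h.map_gen]
    linear_combination -b * b * h.sq_eq
  rw [this]
  exact R.add_mem (R.add_mem (R.mul_mem ha ha) (R.mul_mem (R.mul_mem ha hb) h.trace_mem))
    (R.mul_mem (R.mul_mem hb hb) h.norm_mem)

lemma norm_mul_map_add_mem (m : C) : d * σ m + ε ^ 2 * m ∈ genMultiples R ε := by
  obtain ⟨a, ha, b, hb, rfl⟩ := h.exists_eq m
  rw [mem_genMultiples]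
  refine ⟨t * a + t * t * b - (d * b + d * b), ?_, ?_⟩
  · have ht := h.trace_mem
    have hd := h.norm_mem
    exact R.sub_mem (R.add_mem (R.mul_mem ht ha) (R.mul_mem (R.mul_mem ht ht) hb))
      (R.add_mem (R.mul_mem hd hb) (R.mul_mem hd hb))
  · simp only [map_add, map_mul, h.map_of_mem _ ha, h.map_of_mem _ hb, h.map_gen]
    linear_combination (a + b * ε + b * t) * h.sq_eq

lemma eq_zero_of_mem_of_mem_genMultiples {c : C} (hc : c ∈ R) (hc' : c ∈ genMultiples R ε) :
    c = 0 := by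
  obtain ⟨r, hr, rfl⟩ := mem_genMultiples.1 hc'
  by_contra h0
  have hr0 : r ≠ 0 := right_ne_zero_of_mul h0
  exact h.not_mem (by simpa [hr0] using R.mul_mem hc (R.inv_mem hr))

lemma mk_mem_hermSet_iff (v : Fin 3 → C) (hv : v ≠ 0) :
    Projectivization.mk C v hv ∈ hermSet R σ ε ↔ hermForm σ v ∈ genMultiples R ε := by
  rw [mem_genMultiples]
  refine ⟨?_, fun hq => ⟨v, hv, rfl, hq⟩⟩
  rintro ⟨w, hw, hvw, hq⟩
  obtain ⟨a, rfl⟩ := (mk_eq_mk_iff' C v w hv hw).1 hvw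
  have : hermForm σ (a • w) = (σ a * a) * hermForm σ w := by
    simp only [hermForm, Pi.smul_apply, smul_eq_mul, map_mul]
    ring
  rw [← mem_genMultiples, this]
  exact mul_mem_genMultiples (h.map_mul_self_mem a) (mem_genMultiples.2 hq)

lemma tangentForm_self {u : Fin 3 → C} (hu : hermForm σ u ∈ genMultiples R ε) :
    tangentForm σ ε d u u = 0 := by
  obtain ⟨r, hr, hq⟩ := mem_genMultiples.1 hu
  have hq' := congrArg σ hq
  simp only [hermForm, map_add, map_mul, h.map_map, h.map_of_mem _ hr, h.map_gen] at hq hq'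
  rw [tangentForm_apply]
  linear_combination d * hq - ε ^ 2 * hq' + ε * r * h.sq_eq

/-- Moving `v` along the line joining it to a point `u` of the unital changes the form, modulo
`εR`, by a multiple of the tangent form at `u`. -/
lemma hermForm_add_smul {u : Fin 3 → C} (hu : hermForm σ u ∈ genMultiples R ε)
    (v : Fin 3 → C) (μ : C) :
    d * hermForm σ (v + μ • u) - d * hermForm σ v - σ μ * tangentForm σ ε d u v
      ∈ genMultiples R ε := by
  have h1 := mul_mem_genMultiples (R.mul_mem h.norm_mem (h.map_mul_self_mem μ)) hu
  have h2 := h.norm_mul_map_add_mem (σ μ * (σ (u 1) * v 0 + σ (u 2) * v 2))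
  convert add_mem h1 h2 using 1
  simp only [tangentForm_apply, hermForm, Pi.add_apply, Pi.smul_apply, smul_eq_mul, map_add,
    map_mul, h.map_map]
  ring

lemma hermForm_add_smul_mem_iff {u : Fin 3 → C} (hu : hermForm σ u ∈ genMultiples R ε)
    {v : Fin 3 → C} {μ : C} (hμ : σ μ * tangentForm σ ε d u v ∈ genMultiples R ε) :
    hermForm σ (v + μ • u) ∈ genMultiples R ε ↔ hermForm σ v ∈ genMultiples R ε := by
  rw [← mul_mem_genMultiples_iff h.norm_mem h.norm_ne_zero,
    ← mul_mem_genMultiples_iff (w := hermForm σ v) h.norm_mem h.norm_ne_zero]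
  have h1 := add_mem (h.hermForm_add_smul hu v μ) hμ
  rw [sub_add_cancel] at h1
  exact ⟨fun h2 => by simpa using sub_mem h2 h1, fun h2 => by simpa using add_mem h1 h2⟩

lemma apply_two_eq_zero {w : Fin 3 → C} (hw : hermForm σ w ∈ genMultiples R ε) (h0 : w 0 = 0) :
    w 2 = 0 := by
  have h1 : σ (w 2) * w 2 = 0 :=
    h.eq_zero_of_mem_of_mem_genMultiples (h.map_mul_self_mem _) (by simpa [hermForm, h0] using hw)
  simpa using h1

/-- The tangent line at a point of the unital contains no other point of the unital. -/
lemma tangentForm_ne_zero {u v : Fin 3 → C} (hu : hermForm σ u ∈ genMultiples R ε)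
    (hv : hermForm σ v ∈ genMultiples R ε) (hu0 : u ≠ 0) (hne : ∀ γ : C, v + γ • u ≠ 0) :
    tangentForm σ ε d u v ≠ 0 := by
  intro hF
  have hε := h.gen_ne_zero
  have hd := h.norm_ne_zero
  by_cases h0 : u 0 = 0
  · have h2 := h.apply_two_eq_zero hu h0
    have h1 : u 1 ≠ 0 := fun h1 => hu0 <| by
      ext i
      fin_cases i <;> simp [h0, h1, h2]
    have hv0 : v 0 = 0 := by
      simpa [tangentForm_apply, h0, h2, hε, h1] using hF
    have hv2 := h.apply_two_eq_zero hv hv0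
    refine hne (-v 1 / u 1) ?_
    ext i
    fin_cases i <;> simp [h0, h1, h2, hv0, hv2]
  · set γ := -v 0 / u 0 with hγ
    have hw : hermForm σ (v + γ • u) ∈ genMultiples R ε :=
      (h.hermForm_add_smul_mem_iff hu (by simp [hF])).2 hv
    have hw0 : (v + γ • u) 0 = 0 := by simp [hγ, h0]
    have hw2 := h.apply_two_eq_zero hw hw0
    have hFw : tangentForm σ ε d u (v + γ • u) = 0 := by
      simp [hF, h.tangentForm_self hu]
    rw [tangentForm_apply, hw0, hw2] at hFw
    have hw1 : (v + γ • u) 1 = 0 := by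
      simpa [hd, h0] using hFw
    refine hne γ ?_
    ext i
    fin_cases i
    exacts [hw0, hw1, hw2]

/-- If `v` and `v + γu` represent points of the unital on a line through the point represented by
`u`, then `γ` is the parameter of a transvection preserving the unital. -/
lemma exists_parameter {u v : Fin 3 → C} {γ : C} (hu : hermForm σ u ∈ genMultiples R ε)
    (hv : hermForm σ v ∈ genMultiples R ε) (hw : hermForm σ (v + γ • u) ∈ genMultiples R ε)
    (hF : tangentForm σ ε d u v ≠ 0) :
    ∃ r ∈ R, γ = (t - ε) * r * tangentForm σ ε d u v := by
  have hγ : σ γ * tangentForm σ ε d u v ∈ genMultiples R ε := by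
    have := sub_mem (sub_mem (mul_mem_genMultiples h.norm_mem hw)
      (mul_mem_genMultiples h.norm_mem hv)) (h.hermForm_add_smul hu v γ)
    simpa using this
  obtain ⟨s, hs, hsF⟩ := mem_genMultiples.1 hγ
  generalize tangentForm σ ε d u v = F at *
  refine ⟨s * (σ F * F)⁻¹, R.mul_mem hs (R.inv_mem (h.map_mul_self_mem F)), ?_⟩
  have hσF : σ F ≠ 0 := (map_ne_zero σ).2 hF
  have hsσ := congrArg σ hsF
  simp only [map_mul, h.map_map, h.map_gen, h.map_of_mem _ hs] at hsσ
  field_simp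
  linear_combination hsσ

/-- The center of the transvection with parameter `r` lies on its axis, the tangent line. -/
lemma transvection_center {u : Fin 3 → C} (hu : hermForm σ u ∈ genMultiples R ε) (r : C) :
    (((t - ε) * r) • tangentForm σ ε d u) u = 0 := by
  simp [h.tangentForm_self hu]

lemma isTranslation_transvection {u : Fin 3 → C} (hu0 : u ≠ 0)
    (hu : hermForm σ u ∈ genMultiples R ε) {r : C} (hr : r ∈ R) :
    IsTranslation (hermSet R σ ε) (IsHermBlock R σ ε) (Projectivization.mk C u hu0)
      (collineation (LinearEquiv.transvection (h.transvection_center hu r))) := by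
  have hpre : collineation (LinearEquiv.transvection (h.transvection_center hu r))
      ⁻¹' hermSet R σ ε = hermSet R σ ε := by
    ext P
    induction P using Projectivization.ind with | h v hv =>
    rw [Set.mem_preimage, collineation_mk, h.mk_mem_hermSet_iff, h.mk_mem_hermSet_iff,
      LinearEquiv.transvection.apply]
    apply h.hermForm_add_smul_mem_iff hu
    rw [mem_genMultiples]
    refine ⟨r * (σ (tangentForm σ ε d u v) * tangentForm σ ε d u v),
      R.mul_mem hr (h.map_mul_self_mem _), ?_⟩
    simp only [LinearMap.smul_apply, smul_eq_mul, map_mul, map_sub, h.map_gen,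
      h.map_of_mem _ h.trace_mem, h.map_of_mem _ hr]
    ring
  refine ⟨collineation_isUnitalAuto _ hpre, ?_, ?_⟩
  · rw [collineation_mk, mk_eq_mk_iff']
    exact ⟨1, by rw [LinearEquiv.transvection.apply, h.transvection_center hu r]; simp⟩
  · rintro _ ⟨_, ⟨f, hf, rfl⟩, -, rfl⟩ hz
    have hfu : f u = 0 := (dual_rep_mk_eq_zero_iff f u hu0).1 hz.2
    have hpre' : collineation (LinearEquiv.transvection (h.transvection_center hu r))
        ⁻¹' (hermSet R σ ε ∩ {P | f P.rep = 0}) = hermSet R σ ε ∩ {P | f P.rep = 0} := by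
      rw [Set.preimage_inter, hpre, collineation_preimage_line]
      congr! 4 with P
      simp [LinearMap.transvection.apply, hfu]
    conv_lhs => rw [← hpre']
    exact Set.image_preimage_eq _ (collineation_bijective _).2

end IsQuadraticPair

/-- In a projective plane, a point `y ≠ z` on a line through distinct points `x, z` has a
representative `v + γu`, where `v` and `u` represent `x` and `z`. -/
lemma exists_add_smul_of_collinear (f : (Fin 3 → C) →ₗ[C] C) (hf : f ≠ 0) {u v w : Fin 3 → C}
    (hu0 : u ≠ 0) (hne : ∀ γ : C, v + γ • u ≠ 0) (hne' : ∀ γ : C, w ≠ γ • u)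
    (hu : f u = 0) (hv : f v = 0) (hw : f w = 0) :
    ∃ a γ : C, a ≠ 0 ∧ a • w = v + γ • u := by
  have hrank : Module.finrank C (LinearMap.ker f) = 2 := by
    have := Module.Dual.finrank_ker_add_one_of_ne_zero hf
    simp at this
    omega
  have hli : LinearIndependent C ![(⟨u, hu⟩ : LinearMap.ker f), ⟨v, hv⟩] := by
    rw [LinearIndependent.pair_iff' (by simpa [Subtype.ext_iff] using hu0)]
    intro a ha
    have ha' : a • u = v := congrArg Subtype.val ha
    exact hne (-a) (by simp [← ha'])
  have htop := hli.span_eq_top_of_card_eq_finrank (by simp [hrank])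
  have hc : (⟨w, hw⟩ : LinearMap.ker f) ∈ Submodule.span C (Set.range _) :=
    htop ▸ Submodule.mem_top
  rw [Matrix.range_cons_cons_empty, Submodule.mem_span_pair] at hc
  obtain ⟨b, a, hab⟩ := hc
  have hab' : b • u + a • v = w := congrArg Subtype.val hab
  have ha : a ≠ 0 := by
    rintro rfl
    exact hne' b (by simp [← hab'])
  refine ⟨a⁻¹, a⁻¹ * b, inv_ne_zero ha, ?_⟩
  rw [← hab', smul_add, smul_smul, smul_smul, inv_mul_cancel₀ ha, one_smul, add_comm]

end QuadraticExtension

/-- For any three distinct points `x, y, z` on a block of `H(C|R)`, there is a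
translation with center `z` mapping `x` to `y`. -/
theorem exists_translation_of_three_points_on_block
    {C : Type*} [Field C] (R : Subfield C) (ε t d : C) (σ : C →+* C)
    (hrank : Module.finrank R C = 2)
    (hε : ε ∉ R) (ht : t ∈ R) (hd : d ∈ R)
    (hmin : ε ^ 2 - t * ε + d = 0)
    (hσR : ∀ r ∈ R, σ r = r) (hσε : σ ε = t - ε)
    (B : Set (Projectivization C (Fin 3 → C))) (hB : IsHermBlock R σ ε B)
    (x y z : Projectivization C (Fin 3 → C))
    (hx : x ∈ B) (hy : y ∈ B) (hz : z ∈ B)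
    (hxy : x ≠ y) (hxz : x ≠ z) (hyz : y ≠ z) :
    ∃ φ, IsTranslation (hermSet R σ ε) (IsHermBlock R σ ε) z φ ∧ φ x = y := by
  have h := isQuadraticPair_of_finrank R ε t d σ hrank hε ht hd hmin hσR hσε
  obtain ⟨_, ⟨f, hf, rfl⟩, -, rfl⟩ := hB
  induction x using Projectivization.ind with | h v hv0 =>
  induction y using Projectivization.ind with | h w hw0 =>
  induction z using Projectivization.ind with | h u hu0 =>
  simp only [Set.mem_inter_iff, h.mk_mem_hermSet_iff, Set.mem_ofPred_eq,
    dual_rep_mk_eq_zero_iff] at hx hy hz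
  have hne : ∀ γ : C, v + γ • u ≠ 0 := fun γ hγ => hxz <| (mk_eq_mk_iff' C _ _ hv0 hu0).2
    ⟨-γ, by rw [neg_smul, eq_comm, ← add_eq_zero_iff_eq_neg, hγ]⟩
  have hne' : ∀ γ : C, w ≠ γ • u := fun γ hγ =>
    hyz <| (mk_eq_mk_iff' C _ _ hw0 hu0).2 ⟨γ, hγ.symm⟩
  obtain ⟨a, γ, ha, hγ⟩ := exists_add_smul_of_collinear f hf hu0 hne hne' hz.2 hx.2 hy.2
  have hyγ : Projectivization.mk C (v + γ • u) (hne γ) = Projectivization.mk C w hw0 :=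
    (mk_eq_mk_iff' C _ _ _ _).2 ⟨a, hγ⟩
  have hq : hermForm σ (v + γ • u) ∈ genMultiples R ε := by
    rw [← h.mk_mem_hermSet_iff _ (hne γ), hyγ, h.mk_mem_hermSet_iff]
    exact hy.1
  obtain ⟨r, hr, rfl⟩ := h.exists_parameter hz.1 hx.1 hq
    (h.tangentForm_ne_zero hz.1 hx.1 hu0 hne)
  exact ⟨_, h.isTranslation_transvection hu0 hz.1 hr, hyγ⟩
end
end

section
/- Let p be a point of the generalized hermitian unital H(C|R), let X, Y, Z be three distinct blocks through p, and let B be a block not containing p that meets each of X, Y and Z. Then for each point z ≠ p lying on X ∪ Y ∪ Z there exists a unique block B' of H(C|R) containing z and intersecting X, Y and Z in three distinct points; moreover B' is the image of B under some translation of H(C|R) with center p, and every block through p that meets B ∪ B' meets both B and B'. -/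
noncomputable section

/-- `B'` intersects `X`, `Y` and `Z` in three distinct points. -/
def MeetsInThreeDistinctPoints {P : Type*} (B' X Y Z : Set P) : Prop :=
  ∃ a b c, a ∈ B' ∩ X ∧ b ∈ B' ∩ Y ∧ c ∈ B' ∩ Z ∧ a ≠ b ∧ a ≠ c ∧ b ≠ c

namespace GeneralizedHermitianUnital

open Projectivization

section Incidence

variable {P : Type*} {H : Set P} {Bl : Set P → Prop}

/-- A permutation of the ambient point set that preserves points and blocks of `(H, Bl)`. -/
def PreservesIncidence (H : Set P) (Bl : Set P → Prop) (e : Equiv.Perm P) : Prop :=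
  (∀ x, e x ∈ H ↔ x ∈ H) ∧ ∀ S, Bl (e '' S) ↔ Bl S

theorem PreservesIncidence.symm {e : Equiv.Perm P} (he : PreservesIncidence H Bl e) :
    PreservesIncidence H Bl e.symm := by
  refine ⟨fun x => ?_, fun S => ?_⟩
  · rw [← he.1, e.apply_symm_apply]
  · rw [← he.2, e.image_symm_image]

theorem PreservesIncidence.trans {e f : Equiv.Perm P} (he : PreservesIncidence H Bl e)
    (hf : PreservesIncidence H Bl f) : PreservesIncidence H Bl (e.trans f) := by
  refine ⟨fun x => ?_, fun S => ?_⟩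
  · rw [Equiv.trans_apply, hf.1, he.1]
  · rw [Equiv.coe_trans, Set.image_comp, hf.2, he.2]

theorem PreservesIncidence.image_eq {e : Equiv.Perm P} (he : PreservesIncidence H Bl e) :
    e '' H = H := by
  ext x
  rw [Equiv.image_eq_preimage_symm, Set.mem_preimage, he.symm.1]

theorem PreservesIncidence.isUnitalAuto {e : Equiv.Perm P} (he : PreservesIncidence H Bl e) :
    IsUnitalAuto H Bl e := by
  refine ⟨⟨fun x hx => (he.1 x).2 hx, e.injective.injOn, ?_⟩, fun S hS => (he.2 S).2 hS,
    fun S hS => ⟨e.symm '' S, (he.symm.2 S).2 hS, e.image_symm_image S⟩⟩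
  rw [Set.SurjOn, he.image_eq]

theorem isUnitalAuto_comp {φ ψ : P → P} (hφ : IsUnitalAuto H Bl φ) (hψ : IsUnitalAuto H Bl ψ) :
    IsUnitalAuto H Bl (φ ∘ ψ) := by
  refine ⟨hφ.1.comp hψ.1, fun S hS => ?_, fun S hS => ?_⟩
  · rw [Set.image_comp]
    exact hφ.2.1 _ (hψ.2.1 _ hS)
  · obtain ⟨S', hS', rfl⟩ := hφ.2.2 S hS
    obtain ⟨S'', hS'', rfl⟩ := hψ.2.2 S' hS'
    exact ⟨S'', hS'', Set.image_comp _ _ _⟩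

theorem _root_.IsTranslation.conj {e : Equiv.Perm P} (he : PreservesIncidence H Bl e) {p : P}
    {τ : P → P} (hτ : IsTranslation H Bl (e p) τ) :
    IsTranslation H Bl p (e.symm ∘ τ ∘ e) := by
  refine ⟨isUnitalAuto_comp he.symm.isUnitalAuto (isUnitalAuto_comp hτ.1 he.isUnitalAuto), ?_, ?_⟩
  · simp [hτ.2.1]
  · intro S hS hpS
    rw [Set.image_comp, Set.image_comp, hτ.2.2 _ ((he.2 S).2 hS) (Set.mem_image_of_mem e hpS),
      e.symm_image_image]

theorem meetsInThreeDistinctPoints_image {e : Equiv.Perm P} {S X Y Z : Set P}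
    (h : MeetsInThreeDistinctPoints S X Y Z) :
    MeetsInThreeDistinctPoints (e '' S) (e '' X) (e '' Y) (e '' Z) := by
  obtain ⟨a, b, c, ha, hb, hc, hab, hac, hbc⟩ := h
  exact ⟨e a, e b, e c, ⟨Set.mem_image_of_mem e ha.1, Set.mem_image_of_mem e ha.2⟩,
    ⟨Set.mem_image_of_mem e hb.1, Set.mem_image_of_mem e hb.2⟩,
    ⟨Set.mem_image_of_mem e hc.1, Set.mem_image_of_mem e hc.2⟩,
    e.injective.ne hab, e.injective.ne hac, e.injective.ne hbc⟩

/-- Every block through `p` meeting `B` or its translate meets both. -/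
theorem _root_.IsTranslation.meets_both (hBl : ∀ S, Bl S → S ⊆ H) {p : P} {τ : P → P}
    (hτ : IsTranslation H Bl p τ) {B D : Set P} (hB : Bl B) (hD : Bl D) (hpD : p ∈ D)
    (h : (D ∩ (B ∪ τ '' B)).Nonempty) : (D ∩ B).Nonempty ∧ (D ∩ τ '' B).Nonempty := by
  have hDD := hτ.2.2 D hD hpD
  have key : (D ∩ B).Nonempty := by
    obtain ⟨x, hxD, hxB | ⟨y, hyB, rfl⟩⟩ := h
    · exact ⟨x, hxD, hxB⟩
    · rw [← hDD] at hxD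
      obtain ⟨w, hwD, hw⟩ := hxD
      have := hτ.1.1.injOn (hBl D hD hwD) (hBl B hB hyB) hw
      exact ⟨w, hwD, this ▸ hyB⟩
  refine ⟨key, ?_⟩
  obtain ⟨x, hxD, hxB⟩ := key
  exact ⟨τ x, hDD ▸ Set.mem_image_of_mem τ hxD, Set.mem_image_of_mem τ hxB⟩

/-- Blocks meeting three given blocks through `p` in distinct points are, locally at each
point of these blocks, unique and obtained from each other by translations with center `p`. -/
def UniqueTranslateAt (H : Set P) (Bl : Set P → Prop) (p : P) : Prop :=
  ∀ X Y Z B : Set P, Bl X → Bl Y → Bl Z → X ≠ Y → X ≠ Z → Y ≠ Z → p ∈ X → p ∈ Y → p ∈ Z →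
    Bl B → p ∉ B → (B ∩ X).Nonempty → (B ∩ Y).Nonempty → (B ∩ Z).Nonempty →
    ∀ z, z ≠ p → z ∈ X ∪ Y ∪ Z →
      ∃ B', (Bl B' ∧ z ∈ B' ∧ MeetsInThreeDistinctPoints B' X Y Z) ∧
        (∀ B'', Bl B'' → z ∈ B'' → MeetsInThreeDistinctPoints B'' X Y Z → B'' = B') ∧
        ∃ τ, IsTranslation H Bl p τ ∧ τ '' B = B'

theorem UniqueTranslateAt.of_perm {e : Equiv.Perm P} (he : PreservesIncidence H Bl e) {p : P}
    (h : UniqueTranslateAt H Bl (e p)) : UniqueTranslateAt H Bl p := by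
  intro X Y Z B hX hY hZ hXY hXZ hYZ hpX hpY hpZ hB hpB hBX hBY hBZ z hz hzXYZ
  have hinj := Set.image_injective.2 e.injective
  have himg {S T : Set P} (hST : (S ∩ T).Nonempty) : (e '' S ∩ e '' T).Nonempty := by
    rw [← Set.image_inter e.injective]
    exact hST.image e
  obtain ⟨B', ⟨hB', hzB', hm⟩, huniq, τ, hτ, hτB⟩ :=
    h (e '' X) (e '' Y) (e '' Z) (e '' B) ((he.2 _).2 hX) ((he.2 _).2 hY) ((he.2 _).2 hZ)
      (hinj.ne hXY) (hinj.ne hXZ) (hinj.ne hYZ) (Set.mem_image_of_mem e hpX)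
      (Set.mem_image_of_mem e hpY) (Set.mem_image_of_mem e hpZ) ((he.2 _).2 hB)
      (by rwa [e.injective.mem_set_image]) (himg hBX) (himg hBY) (himg hBZ) (e z)
      (e.injective.ne hz)
      (by rw [← Set.image_union, ← Set.image_union]; exact Set.mem_image_of_mem e hzXYZ)
  refine ⟨e.symm '' B', ⟨(he.symm.2 _).2 hB', ⟨e z, hzB', e.symm_apply_apply z⟩, ?_⟩, ?_,
    e.symm ∘ τ ∘ e, hτ.conj he, by rw [Set.image_comp, Set.image_comp, hτB]⟩
  · have := meetsInThreeDistinctPoints_image (e := e.symm) hm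
    simpa only [e.symm_image_image] using this
  · intro B'' hB'' hzB'' hm''
    rw [← huniq (e '' B'') ((he.2 _).2 hB'') (Set.mem_image_of_mem e hzB'')
      (meetsInThreeDistinctPoints_image hm''), e.symm_image_image]

end Incidence

variable {C : Type*} [Field C]

/-- `σ` is the generator of `Aut_R(C)` for a quadratic extension `C = R(ε)`, where `ε` has
trace `t` and norm `d`. -/
structure IsQuadratic (R : Subfield C) (ε t d : C) (σ : C →+* C) : Prop where
  finrank_eq : Module.finrank R C = 2
  notMem : ε ∉ R
  trace_mem : t ∈ R
  norm_mem : d ∈ R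
  minpoly : ε ^ 2 - t * ε + d = 0
  map_of_mem : ∀ r ∈ R, σ r = r
  map_gen : σ ε = t - ε

/-- The additive subgroup `εR` of `C`. -/
def epsLine (R : Subfield C) (ε : C) : AddSubgroup C :=
  R.toAddSubgroup.map (AddMonoidHom.mulLeft ε)

theorem mem_epsLine {R : Subfield C} {ε x : C} : x ∈ epsLine R ε ↔ ∃ r ∈ R, x = ε * r := by
  simp only [epsLine, AddSubgroup.mem_map, AddMonoidHom.coe_mulLeft, eq_comm]
  rfl

theorem mul_mem_epsLine {R : Subfield C} {ε r x : C} (hr : r ∈ R) (hx : x ∈ epsLine R ε) :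
    r * x ∈ epsLine R ε := by
  obtain ⟨s, hs, rfl⟩ := mem_epsLine.1 hx
  exact mem_epsLine.2 ⟨r * s, mul_mem hr hs, by ring⟩

theorem mul_mem_epsLine_iff {R : Subfield C} {ε r x : C} (hr : r ∈ R) (h0 : r ≠ 0) :
    r * x ∈ epsLine R ε ↔ x ∈ epsLine R ε := by
  refine ⟨fun h => ?_, mul_mem_epsLine hr⟩
  simpa [h0] using mul_mem_epsLine (inv_mem hr) h

namespace IsQuadratic

variable {R : Subfield C} {ε t d : C} {σ : C →+* C}

theorem exists_add_mul (h : IsQuadratic R ε t d σ) (x : C) :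
    ∃ a ∈ R, ∃ b ∈ R, x = a + b * ε := by
  have hli : LinearIndependent R ![(1 : C), ε] := by
    rw [LinearIndependent.pair_iff' one_ne_zero]
    intro a ha
    apply h.notMem
    rw [← ha, Subfield.smul_def, smul_eq_mul, mul_one]
    exact a.2
  have hspan := hli.span_eq_top_of_card_eq_finrank (by simp [h.finrank_eq])
  have hx : x ∈ Submodule.span R (Set.range ![(1 : C), ε]) := hspan ▸ Submodule.mem_top
  rw [Matrix.range_cons, Matrix.range_cons, Matrix.range_empty, Set.union_empty,
    Set.singleton_union, Submodule.mem_span_pair] at hx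
  obtain ⟨a, b, hab⟩ := hx
  refine ⟨a, a.2, b, b.2, ?_⟩
  simpa [Subfield.smul_def] using hab.symm

theorem eq_zero_of_mem_epsLine (h : IsQuadratic R ε t d σ) {r : C} (hr : r ∈ R)
    (hr' : r ∈ epsLine R ε) : r = 0 := by
  obtain ⟨s, hs, rfl⟩ := mem_epsLine.1 hr'
  by_contra h0
  have hs0 : s ≠ 0 := right_ne_zero_of_mul h0
  apply h.notMem
  have := div_mem hr hs
  rwa [mul_div_cancel_right₀ _ hs0] at this

theorem gen_ne_zero (h : IsQuadratic R ε t d σ) : ε ≠ 0 := fun h0 => h.notMem (h0 ▸ zero_mem R)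

theorem norm_ne_zero (h : IsQuadratic R ε t d σ) : d ≠ 0 := by
  rintro rfl
  have := h.minpoly
  have h1 : ε * (ε - t) = 0 := by linear_combination this
  rcases mul_eq_zero.1 h1 with h2 | h2
  · exact h.gen_ne_zero h2
  · exact h.notMem (sub_eq_zero.1 h2 ▸ h.trace_mem)

theorem map_add_mul (h : IsQuadratic R ε t d σ) {a b : C} (ha : a ∈ R) (hb : b ∈ R) :
    σ (a + b * ε) = a + b * (t - ε) := by
  rw [map_add, map_mul, h.map_of_mem a ha, h.map_of_mem b hb, h.map_gen]

theorem map_mul_self_mem (h : IsQuadratic R ε t d σ) (x : C) : σ x * x ∈ R := by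
  obtain ⟨a, ha, b, hb, rfl⟩ := h.exists_add_mul x
  rw [h.map_add_mul ha hb, show (a + b * (t - ε)) * (a + b * ε) = a * a + a * b * t + b * b * d by
    linear_combination -b ^ 2 * h.minpoly]
  have ht := h.trace_mem
  have hd := h.norm_mem
  exact add_mem (add_mem (mul_mem ha ha) (mul_mem (mul_mem ha hb) ht)) (mul_mem (mul_mem hb hb) hd)

theorem map_map (h : IsQuadratic R ε t d σ) (x : C) : σ (σ x) = x := by
  obtain ⟨a, ha, b, hb, rfl⟩ := h.exists_add_mul x
  rw [h.map_add_mul ha hb, map_add, map_mul, map_sub, h.map_of_mem a ha, h.map_of_mem b hb,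
    h.map_gen, h.map_of_mem t h.trace_mem]
  ring

/-- The slope making `x ↦ x + σ x + λ x` take values in `εR`. -/
theorem twist_mem_epsLine (h : IsQuadratic R ε t d σ) (x : C) :
    x + σ x + (ε * t / d - 2) * x ∈ epsLine R ε := by
  obtain ⟨a, ha, b, hb, rfl⟩ := h.exists_add_mul x
  have ht := h.trace_mem
  have hd := h.norm_mem
  refine mem_epsLine.2 ⟨t * a / d - (b + b) + t * t * b / d, ?_, ?_⟩
  · exact add_mem (sub_mem (div_mem (mul_mem ht ha) hd) (add_mem hb hb))
      (div_mem (mul_mem (mul_mem ht ht) hb) hd)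
  · rw [h.map_add_mul ha hb]
    have hd0 := h.norm_ne_zero
    field_simp
    linear_combination b * t * h.minpoly

theorem swap_mem_epsLine_iff (h : IsQuadratic R ε t d σ) (x : C) :
    ε ^ 2 / d * σ x ∈ epsLine R ε ↔ x ∈ epsLine R ε := by
  obtain ⟨a, ha, b, hb, rfl⟩ := h.exists_add_mul x
  have ht := h.trace_mem
  have hd := h.norm_mem
  have hd0 := h.norm_ne_zero
  have key : ε ^ 2 / d * σ (a + b * ε) = ε * b + (ε * t / d * a - a) := by
    rw [h.map_add_mul ha hb]
    field_simp
    linear_combination (a - b * ε) * h.minpoly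
  have h1 : ε * b ∈ epsLine R ε := mem_epsLine.2 ⟨b, hb, rfl⟩
  have h2 : ε * t / d * a ∈ epsLine R ε :=
    mem_epsLine.2 ⟨t / d * a, mul_mem (div_mem ht hd) ha, by ring⟩
  rw [key, AddSubgroup.add_mem_cancel_left _ h1, sub_eq_add_neg,
    AddSubgroup.add_mem_cancel_left _ h2, neg_mem_iff, mul_comm b,
    AddSubgroup.add_mem_cancel_right _ h1]

/-- Two nonvertical lines carrying points of the unital over the same three parameters are
parallel. -/
theorem slope_eq (h : IsQuadratic R ε t d σ) {a b a' b' : C} {z : Fin 3 → C}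
    (hz : Function.Injective z) (h1 : ∀ i, a * z i + b + σ (z i) * z i ∈ epsLine R ε)
    (h2 : ∀ i, a' * z i + b' + σ (z i) * z i ∈ epsLine R ε) : a = a' := by
  by_contra hne
  have hk : a - a' ≠ 0 := sub_ne_zero.2 hne
  have h3 : ∀ i, ∃ r ∈ R, (a - a') * z i + (b - b') = ε * r := by
    intro i
    have := sub_mem (h1 i) (h2 i)
    rw [show a * z i + b + σ (z i) * z i - (a' * z i + b' + σ (z i) * z i)
      = (a - a') * z i + (b - b') by ring] at this
    exact mem_epsLine.1 this
  choose r hr hzr using h3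
  set u := -(b - b') / (a - a') with hu
  set v := ε / (a - a') with hv
  have hv0 : v ≠ 0 := div_ne_zero h.gen_ne_zero hk
  have hzi : ∀ i, z i = u + v * r i := by
    intro i
    rw [hu, hv]
    field_simp
    linear_combination hzr i
  have hrne : ∀ i j, i ≠ j → r i - r j ≠ 0 := by
    intro i j hij h0
    apply hij
    apply hz
    rw [hzi, hzi, sub_eq_zero.1 h0]
  have h4 : ∀ i j, i ≠ j →
      σ v * v * (r i + r j) + (a * v + σ u * v + σ v * u) ∈ epsLine R ε := by
    intro i j hij
    rw [← mul_mem_epsLine_iff (sub_mem (hr i) (hr j)) (hrne i j hij)]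
    have := sub_mem (h1 i) (h1 j)
    rw [hzi i, hzi j, map_add, map_add, map_mul, map_mul, h.map_of_mem _ (hr i),
      h.map_of_mem _ (hr j)] at this
    convert this using 1
    ring
  have h5 := sub_mem (h4 0 1 (by decide)) (h4 1 2 (by decide))
  rw [show σ v * v * (r 0 + r 1) + (a * v + σ u * v + σ v * u) -
    (σ v * v * (r 1 + r 2) + (a * v + σ u * v + σ v * u)) = (r 0 - r 2) * (σ v * v) by ring,
    mul_mem_epsLine_iff (sub_mem (hr 0) (hr 2)) (hrne 0 2 (by decide))] at h5
  have h6 := h.eq_zero_of_mem_epsLine (h.map_mul_self_mem v) h5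
  rcases mul_eq_zero.1 h6 with h7 | h7
  · exact hv0 ((map_eq_zero σ).1 h7)
  · exact hv0 h7

end IsQuadratic

/-- The form `σ(X)·Y + σ(Z)·Z` defining the unital. -/
def hermForm (σ : C →+* C) (v : Fin 3 → C) : C := σ (v 0) * v 1 + σ (v 2) * v 2

theorem hermForm_smul (σ : C →+* C) (k : C) (v : Fin 3 → C) :
    hermForm σ (k • v) = σ k * k * hermForm σ v := by
  simp only [hermForm, Pi.smul_apply, smul_eq_mul, map_mul]
  ring

section Coordinates

variable {R : Subfield C} {ε t d : C} {σ : C →+* C}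

theorem mk_mem_hermSet (h : IsQuadratic R ε t d σ) {v : Fin 3 → C} (hv : v ≠ 0) :
    mk C v hv ∈ hermSet R σ ε ↔ hermForm σ v ∈ epsLine R ε := by
  constructor
  · rintro ⟨w, hw, hvw, hwr⟩
    obtain ⟨k, rfl⟩ := (mk_eq_mk_iff' C v w hv hw).1 hvw
    rw [hermForm_smul]
    exact mul_mem_epsLine (h.map_mul_self_mem k) (mem_epsLine.2 hwr)
  · intro hv'
    exact ⟨v, hv, rfl, mem_epsLine.1 hv'⟩

theorem mk_mem_line (f : (Fin 3 → C) →ₗ[C] C) {v : Fin 3 → C} (hv : v ≠ 0) :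
    mk C v hv ∈ {P : Projectivization C (Fin 3 → C) | f P.rep = 0} ↔ f v = 0 := by
  obtain ⟨k, hk⟩ := exists_smul_eq_mk_rep C v hv
  rw [Set.mem_ofPred_eq, ← hk, Units.smul_def, map_smul, smul_eq_mul,
    mul_eq_zero_iff_left k.ne_zero]

/-- The permutation of the projective plane induced by a linear automorphism. -/
def projPerm (g : (Fin 3 → C) ≃ₗ[C] (Fin 3 → C)) :
    Equiv.Perm (Projectivization C (Fin 3 → C)) :=
  MulAction.toPerm g

theorem projPerm_mk (g : (Fin 3 → C) ≃ₗ[C] (Fin 3 → C)) {v : Fin 3 → C} (hv : v ≠ 0) :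
    projPerm g (mk C v hv) = mk C (g v) (g.map_ne_zero_iff.2 hv) := rfl

theorem projPerm_symm (g : (Fin 3 → C) ≃ₗ[C] (Fin 3 → C)) :
    projPerm g.symm = (projPerm g).symm := by
  ext P
  induction P using Projectivization.ind with | h v hv =>
  rw [Equiv.eq_symm_apply, projPerm_mk, projPerm_mk]
  congr 1
  exact g.apply_symm_apply v

theorem projPerm_mem_hermSet (h : IsQuadratic R ε t d σ) {g : (Fin 3 → C) ≃ₗ[C] (Fin 3 → C)}
    (hg : ∀ v, hermForm σ (g v) ∈ epsLine R ε ↔ hermForm σ v ∈ epsLine R ε)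
    (P : Projectivization C (Fin 3 → C)) :
    projPerm g P ∈ hermSet R σ ε ↔ P ∈ hermSet R σ ε := by
  induction P using Projectivization.ind with | h v hv =>
  rw [projPerm_mk, mk_mem_hermSet h, mk_mem_hermSet h, hg]

theorem isHermBlock_image (h : IsQuadratic R ε t d σ) {g : (Fin 3 → C) ≃ₗ[C] (Fin 3 → C)}
    (hg : ∀ v, hermForm σ (g v) ∈ epsLine R ε ↔ hermForm σ v ∈ epsLine R ε)
    {S : Set (Projectivization C (Fin 3 → C))} (hS : IsHermBlock R σ ε S) :
    IsHermBlock R σ ε (projPerm g '' S) := by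
  obtain ⟨ℓ, ⟨f, hf, rfl⟩, hnt, rfl⟩ := hS
  have himg : projPerm g '' (hermSet R σ ε ∩ {P | f P.rep = 0}) =
      hermSet R σ ε ∩ {P | (f ∘ₗ g.symm.toLinearMap) P.rep = 0} := by
    ext P
    obtain ⟨Q, rfl⟩ := (projPerm g).surjective P
    rw [(projPerm g).injective.mem_set_image, Set.mem_inter_iff, Set.mem_inter_iff,
      projPerm_mem_hermSet h hg]
    induction Q using Projectivization.ind with | h v hv =>
    rw [projPerm_mk, mk_mem_line, mk_mem_line]
    simp
  refine ⟨_, ⟨f ∘ₗ g.symm.toLinearMap, fun h0 => hf ?_, rfl⟩, ?_, himg⟩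
  · ext1 i
    have := LinearMap.congr_fun h0 (g (Pi.single i 1))
    ext
    simpa using this
  · rw [← himg]
    exact hnt.image (projPerm g).injective

theorem preservesIncidence_projPerm (h : IsQuadratic R ε t d σ)
    {g : (Fin 3 → C) ≃ₗ[C] (Fin 3 → C)}
    (hg : ∀ v, hermForm σ (g v) ∈ epsLine R ε ↔ hermForm σ v ∈ epsLine R ε) :
    PreservesIncidence (hermSet R σ ε) (IsHermBlock R σ ε) (projPerm g) := by
  refine ⟨projPerm_mem_hermSet h hg, fun S => ⟨fun hS => ?_, isHermBlock_image h hg⟩⟩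
  have hg' : ∀ v, hermForm σ (g.symm v) ∈ epsLine R ε ↔ hermForm σ v ∈ epsLine R ε := by
    intro v
    rw [← hg, g.apply_symm_apply]
  have := isHermBlock_image h hg' hS
  rwa [projPerm_symm, Equiv.symm_image_image] at this

/-- The point `[0,1,0]`. -/
def ptInf (C : Type*) [Field C] : Projectivization C (Fin 3 → C) :=
  mk C ![0, 1, 0] (fun h => one_ne_zero (congrFun h 1))

/-- The point `[1,y,z]`. -/
def ptAff (y z : C) : Projectivization C (Fin 3 → C) :=
  mk C ![1, y, z] (fun h => one_ne_zero (congrFun h 0))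

theorem ptAff_inj {y z y' z' : C} : ptAff y z = ptAff y' z' ↔ y = y' ∧ z = z' := by
  refine ⟨fun h => ?_, fun h => by rw [h.1, h.2]⟩
  obtain ⟨k, hk⟩ := (mk_eq_mk_iff' C _ _ _ _).1 h
  have h0 := congrFun hk 0
  have h1 := congrFun hk 1
  have h2 := congrFun hk 2
  simp at h0 h1 h2
  subst h0
  simp at h1 h2
  exact ⟨h1.symm, h2.symm⟩

theorem ptAff_ne_ptInf {y z : C} : ptAff y z ≠ ptInf C := by
  intro h
  obtain ⟨k, hk⟩ := (mk_eq_mk_iff' C _ _ _ _).1 h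
  have h0 := congrFun hk 0
  simp at h0

theorem ptInf_mem (h : IsQuadratic R ε t d σ) : ptInf C ∈ hermSet R σ ε := by
  rw [ptInf, mk_mem_hermSet h]
  simp [hermForm]

theorem ptAff_mem (h : IsQuadratic R ε t d σ) {y z : C} :
    ptAff y z ∈ hermSet R σ ε ↔ y + σ z * z ∈ epsLine R ε := by
  rw [ptAff, mk_mem_hermSet h]
  simp [hermForm]

theorem eq_ptInf_or_ptAff (h : IsQuadratic R ε t d σ) {P : Projectivization C (Fin 3 → C)}
    (hP : P ∈ hermSet R σ ε) : P = ptInf C ∨ ∃ y z, P = ptAff y z := by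
  induction P using Projectivization.ind with | h v hv =>
  by_cases h0 : v 0 = 0
  · left
    rw [mk_mem_hermSet h, hermForm, h0, map_zero, zero_mul, zero_add] at hP
    have h2 : v 2 = 0 := by
      have := h.eq_zero_of_mem_epsLine (h.map_mul_self_mem _) hP
      simpa using this
    refine (mk_eq_mk_iff' C _ _ _ _).2 ⟨v 1, ?_⟩
    ext i
    fin_cases i <;> simp [h0, h2]
  · right
    refine ⟨v 1 / v 0, v 2 / v 0, (mk_eq_mk_iff' C _ _ _ _).2 ⟨v 0, ?_⟩⟩
    ext i
    fin_cases i <;> simp [h0, mul_div_cancel₀]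

theorem _root_.IsHermBlock.subset {S : Set (Projectivization C (Fin 3 → C))}
    (hS : IsHermBlock R σ ε S) : S ⊆ hermSet R σ ε := by
  obtain ⟨ℓ, -, -, rfl⟩ := hS
  exact Set.inter_subset_left

theorem linearMap_apply_fin_three (f : (Fin 3 → C) →ₗ[C] C) (x y z : C) :
    f ![x, y, z] = x * f ![1, 0, 0] + y * f ![0, 1, 0] + z * f ![0, 0, 1] := by
  rw [show ![x, y, z] = x • ![1, 0, 0] + y • ![0, 1, 0] + z • ![0, 0, (1 : C)] by
    ext i; fin_cases i <;> simp]
  simp only [map_add, map_smul, smul_eq_mul]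

theorem _root_.IsHermBlock.exists_vertical (h : IsQuadratic R ε t d σ)
    {S : Set (Projectivization C (Fin 3 → C))} (hS : IsHermBlock R σ ε S) (hi : ptInf C ∈ S) :
    ∃ c, ∀ y z, ptAff y z ∈ S ↔ z = c ∧ y + σ z * z ∈ epsLine R ε := by
  obtain ⟨ℓ, ⟨f, hf, rfl⟩, hnt, rfl⟩ := hS
  have hβ : f ![0, 1, 0] = 0 := (mk_mem_line f _).1 hi.2
  have hmem : ∀ y z, ptAff y z ∈ hermSet R σ ε ∩ {P | f P.rep = 0} ↔
      y + σ z * z ∈ epsLine R ε ∧ f ![1, 0, 0] + z * f ![0, 0, 1] = 0 := by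
    intro y z
    rw [Set.mem_inter_iff, ptAff_mem h, ptAff, mk_mem_line, linearMap_apply_fin_three, hβ]
    simp
  by_cases hγ : f ![0, 0, 1] = 0
  · exfalso
    obtain ⟨P, hP, hPi⟩ := hnt.exists_ne (ptInf C)
    obtain rfl | ⟨y, z, rfl⟩ := eq_ptInf_or_ptAff h hP.1
    · exact hPi rfl
    · have h0 := ((hmem y z).1 hP).2
      rw [hγ, mul_zero, add_zero] at h0
      apply hf
      apply LinearMap.ext
      intro v
      rw [show v = ![v 0, v 1, v 2] by ext i; fin_cases i <;> rfl,
        linearMap_apply_fin_three, h0, hβ, hγ]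
      simp
  · refine ⟨-f ![1, 0, 0] / f ![0, 0, 1], fun y z => ?_⟩
    rw [hmem, eq_div_iff hγ, and_comm, eq_neg_iff_add_eq_zero, add_comm (f _)]

theorem _root_.IsHermBlock.exists_affine (h : IsQuadratic R ε t d σ)
    {S : Set (Projectivization C (Fin 3 → C))} (hS : IsHermBlock R σ ε S) (hi : ptInf C ∉ S) :
    ∃ a b, ∀ y z, ptAff y z ∈ S ↔ y = a * z + b ∧ y + σ z * z ∈ epsLine R ε := by
  obtain ⟨ℓ, ⟨f, hf, rfl⟩, hnt, rfl⟩ := hS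
  have hβ : f ![0, 1, 0] ≠ 0 := fun h0 => hi ⟨ptInf_mem h, (mk_mem_line f _).2 h0⟩
  refine ⟨-f ![0, 0, 1] / f ![0, 1, 0], -f ![1, 0, 0] / f ![0, 1, 0], fun y z => ?_⟩
  rw [Set.mem_inter_iff, ptAff_mem h, ptAff, mk_mem_line, linearMap_apply_fin_three, and_comm]
  refine and_congr_left fun _ => ⟨fun h0 => ?_, fun h0 => ?_⟩
  · field_simp
    linear_combination h0
  · rw [h0]
    field_simp
    ring

theorem _root_.IsHermBlock.ext (h : IsQuadratic R ε t d σ)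
    {S T : Set (Projectivization C (Fin 3 → C))} (hS : IsHermBlock R σ ε S)
    (hT : IsHermBlock R σ ε T) (hi : ptInf C ∈ S ↔ ptInf C ∈ T)
    (ha : ∀ y z, ptAff y z ∈ S ↔ ptAff y z ∈ T) : S = T := by
  ext P
  refine ⟨fun hP => ?_, fun hP => ?_⟩
  · obtain rfl | ⟨y, z, rfl⟩ := eq_ptInf_or_ptAff h (hS.subset hP)
    exacts [hi.1 hP, (ha y z).1 hP]
  · obtain rfl | ⟨y, z, rfl⟩ := eq_ptInf_or_ptAff h (hT.subset hP)
    exacts [hi.2 hP, (ha y z).2 hP]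

/-- The linear automorphism inducing `(y, z) ↦ (y + a z + b, z + c)` on affine points. -/
def shear (a b c : C) : (Fin 3 → C) ≃ₗ[C] (Fin 3 → C) where
  toFun v := ![v 0, v 1 + a * v 2 + b * v 0, v 2 + c * v 0]
  invFun v := ![v 0, v 1 - a * (v 2 - c * v 0) - b * v 0, v 2 - c * v 0]
  map_add' v w := by
    ext i; fin_cases i <;> simp <;> ring
  map_smul' k v := by
    ext i; fin_cases i <;> simp <;> ring
  left_inv v := by
    ext i; fin_cases i <;> simp; ring
  right_inv v := by
    ext i; fin_cases i <;> simp; ring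

theorem shear_apply (a b c : C) (v : Fin 3 → C) :
    shear a b c v = ![v 0, v 1 + a * v 2 + b * v 0, v 2 + c * v 0] := rfl

theorem projPerm_shear_ptInf (a b c : C) : projPerm (shear a b c) (ptInf C) = ptInf C := by
  simp only [ptInf, projPerm_mk]
  congr 1
  simp [shear_apply]

theorem projPerm_shear_ptAff (a b c y z : C) :
    projPerm (shear a b c) (ptAff y z) = ptAff (y + a * z + b) (z + c) := by
  simp only [ptAff, projPerm_mk]
  congr 1
  simp [shear_apply]

theorem preservesIncidence_shear (h : IsQuadratic R ε t d σ) {b c : C}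
    (hb : b + σ c * c ∈ epsLine R ε) :
    PreservesIncidence (hermSet R σ ε) (IsHermBlock R σ ε)
      (projPerm (shear ((ε * t / d - 2) * σ c) b c)) := by
  apply preservesIncidence_projPerm h
  intro v
  have key : hermForm σ (shear ((ε * t / d - 2) * σ c) b c v) = hermForm σ v +
      ((σ (c * v 0) * v 2 + σ (σ (c * v 0) * v 2) + (ε * t / d - 2) * (σ (c * v 0) * v 2)) +
        σ (v 0) * v 0 * (b + σ c * c)) := by
    simp only [hermForm, shear_apply, map_mul, h.map_map, map_add, Matrix.cons_val]
    ring
  rw [key]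
  exact AddSubgroup.add_mem_cancel_right _
    (add_mem (h.twist_mem_epsLine _) (mul_mem_epsLine (h.map_mul_self_mem _) hb))

/-- The linear automorphism `(X, Y, Z) ↦ (Y, aX, Z)`. -/
def swap (a : C) (ha : a ≠ 0) : (Fin 3 → C) ≃ₗ[C] (Fin 3 → C) where
  toFun v := ![v 1, a * v 0, v 2]
  invFun v := ![a⁻¹ * v 1, v 0, v 2]
  map_add' v w := by
    ext i; fin_cases i <;> simp; ring
  map_smul' k v := by
    ext i; fin_cases i <;> simp; ring
  left_inv v := by
    ext i; fin_cases i <;> simp [ha]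
  right_inv v := by
    ext i; fin_cases i <;> simp [ha]

theorem swap_apply (a : C) (ha : a ≠ 0) (v : Fin 3 → C) : swap a ha v = ![v 1, a * v 0, v 2] :=
  rfl

theorem projPerm_swap_ptAff (a : C) (ha : a ≠ 0) :
    projPerm (swap a ha) (ptAff 0 0) = ptInf C := by
  simp only [ptAff, ptInf, projPerm_mk]
  refine (mk_eq_mk_iff' C _ _ _ _).2 ⟨a, ?_⟩
  simp [swap_apply]

theorem preservesIncidence_swap (h : IsQuadratic R ε t d σ) (ha : -ε ^ 2 / d ≠ 0) :
    PreservesIncidence (hermSet R σ ε) (IsHermBlock R σ ε) (projPerm (swap (-ε ^ 2 / d) ha)) := by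
  apply preservesIncidence_projPerm h
  intro v
  have hd0 := h.norm_ne_zero
  have key : hermForm σ (swap (-ε ^ 2 / d) ha v) =
      -(ε ^ 2 / d * σ (hermForm σ v)) + ε * (t / d * (σ (v 2) * v 2)) := by
    simp only [hermForm, swap_apply, map_mul, h.map_map, map_add, Matrix.cons_val]
    field_simp
    linear_combination σ (v 2) * v 2 * h.minpoly
  rw [key, AddSubgroup.add_mem_cancel_right _ (mem_epsLine.2 ⟨_, mul_mem
    (div_mem h.trace_mem h.norm_mem) (h.map_mul_self_mem _), rfl⟩), neg_mem_iff,
    h.swap_mem_epsLine_iff]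

/-- Every point of the unital can be moved to `[0,1,0]`. -/
theorem exists_preservesIncidence_eq_ptInf (h : IsQuadratic R ε t d σ)
    {p : Projectivization C (Fin 3 → C)} (hp : p ∈ hermSet R σ ε) :
    ∃ e, PreservesIncidence (hermSet R σ ε) (IsHermBlock R σ ε) e ∧ e p = ptInf C := by
  obtain rfl | ⟨y, z, rfl⟩ := eq_ptInf_or_ptAff h hp
  · exact ⟨Equiv.refl _, ⟨fun x => Iff.rfl, fun S => by simp⟩, rfl⟩
  · rw [ptAff_mem h] at hp
    have hb : (-y - (ε * t / d - 2) * σ (-z) * z) + σ (-z) * -z ∈ epsLine R ε := by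
      have h1 : ε * (t / d * (σ z * z)) ∈ epsLine R ε := mem_epsLine.2 ⟨_, mul_mem
        (div_mem h.trace_mem h.norm_mem) (h.map_mul_self_mem z), rfl⟩
      convert sub_mem h1 hp using 1
      rw [map_neg]
      ring
    have ha : -ε ^ 2 / d ≠ 0 :=
      div_ne_zero (neg_ne_zero.2 (pow_ne_zero 2 h.gen_ne_zero)) h.norm_ne_zero
    refine ⟨_, (preservesIncidence_shear h hb).trans (preservesIncidence_swap h ha), ?_⟩
    rw [Equiv.trans_apply, projPerm_shear_ptAff]
    convert projPerm_swap_ptAff _ ha using 3 <;> ring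

/-- The elations `(y, z) ↦ (y + s, z)` with `s ∈ εR` are translations with center `[0,1,0]`. -/
theorem isTranslation_shear (h : IsQuadratic R ε t d σ) {s : C} (hs : s ∈ epsLine R ε) :
    IsTranslation (hermSet R σ ε) (IsHermBlock R σ ε) (ptInf C) (projPerm (shear 0 s 0)) := by
  have hpres := preservesIncidence_shear h (b := s) (c := 0) (by simpa using hs)
  rw [map_zero, mul_zero] at hpres
  refine ⟨hpres.isUnitalAuto, projPerm_shear_ptInf _ _ _, fun S hS hi => ?_⟩
  obtain ⟨c, hc⟩ := IsHermBlock.exists_vertical h hS hi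
  refine IsHermBlock.ext h ((hpres.2 S).2 hS) hS
    (iff_of_true ⟨_, hi, projPerm_shear_ptInf _ _ _⟩ hi) fun y z => ?_
  have hyz : ptAff y z = projPerm (shear 0 s 0) (ptAff (y - s) z) := by
    rw [projPerm_shear_ptAff]
    congr 1 <;> ring
  rw [hyz, (projPerm (shear 0 s 0)).injective.mem_set_image, ← hyz, hc, hc,
    show y - s + σ z * z = y + σ z * z - s by ring, sub_eq_add_neg,
    AddSubgroup.add_mem_cancel_right _ (neg_mem hs)]

/-- A block meeting three distinct blocks through `[0,1,0]` in distinct points does not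
contain `[0,1,0]`. -/
theorem ptInf_notMem_of_meets (h : IsQuadratic R ε t d σ)
    {S : Set (Projectivization C (Fin 3 → C))} (hS : IsHermBlock R σ ε S)
    {T : Fin 3 → Set (Projectivization C (Fin 3 → C))} {c : Fin 3 → C}
    (hc : Function.Injective c)
    (hT : ∀ i y z, ptAff y z ∈ T i → z = c i) (hTH : ∀ i, T i ⊆ hermSet R σ ε)
    (hm : MeetsInThreeDistinctPoints S (T 0) (T 1) (T 2)) : ptInf C ∉ S := by
  intro hi
  obtain ⟨k, hk⟩ := IsHermBlock.exists_vertical h hS hi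
  have key : ∀ i P, P ∈ S ∩ T i → P = ptInf C ∨ c i = k := by
    intro i P hP
    obtain rfl | ⟨y, z, rfl⟩ := eq_ptInf_or_ptAff h (hTH i hP.2)
    · exact Or.inl rfl
    · exact Or.inr ((hT i y z hP.2).symm.trans ((hk y z).1 hP.1).1)
  have hne : ∀ i j, i ≠ j → c i ≠ c j := fun i j hij => hc.ne hij
  obtain ⟨P, Q, W, hP, hQ, hW, hPQ, hPW, hQW⟩ := hm
  have h01 := hne 0 1 (by decide)
  have h02 := hne 0 2 (by decide)
  have h12 := hne 1 2 (by decide)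
  rcases key 0 P hP with h0 | h0 <;> rcases key 1 Q hQ with h1 | h1 <;>
    rcases key 2 W hW with h2 | h2 <;> simp_all

theorem uniqueTranslateAt_ptInf (h : IsQuadratic R ε t d σ) :
    UniqueTranslateAt (hermSet R σ ε) (IsHermBlock R σ ε) (ptInf C) := by
  intro X Y Z B hX hY hZ hXY hXZ hYZ hiX hiY hiZ hB hiB hBX hBY hBZ p hp hpXYZ
  obtain ⟨T, hT0, hT1, hT2⟩ : ∃ T : Fin 3 → Set (Projectivization C (Fin 3 → C)),
    T 0 = X ∧ T 1 = Y ∧ T 2 = Z := ⟨![X, Y, Z], rfl, rfl, rfl⟩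
  have hTb : ∀ i, IsHermBlock R σ ε (T i) := by
    rw [Fin.forall_fin_succ, Fin.forall_fin_two]
    subst hT0 hT1 hT2
    exact ⟨hX, hY, hZ⟩
  have hTi : ∀ i, ptInf C ∈ T i := by
    rw [Fin.forall_fin_succ, Fin.forall_fin_two]
    subst hT0 hT1 hT2
    exact ⟨hiX, hiY, hiZ⟩
  have hBT : ∀ i, (B ∩ T i).Nonempty := by
    rw [Fin.forall_fin_succ, Fin.forall_fin_two]
    subst hT0 hT1 hT2
    exact ⟨hBX, hBY, hBZ⟩
  have hTinj : Function.Injective T := by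
    subst hT0 hT1 hT2
    intro i j hij
    fin_cases i <;> fin_cases j <;> simp_all
  have hpT : ∃ i, p ∈ T i := by
    subst hT0 hT1 hT2
    rcases hpXYZ with (hpX | hpY) | hpZ
    exacts [⟨0, hpX⟩, ⟨1, hpY⟩, ⟨2, hpZ⟩]
  subst hT0 hT1 hT2
  choose c hc using fun i => IsHermBlock.exists_vertical h (hTb i) (hTi i)
  have hcinj : Function.Injective c := by
    intro i j hij
    apply hTinj
    refine IsHermBlock.ext h (hTb i) (hTb j) (iff_of_true (hTi i) (hTi j)) fun y z => ?_
    rw [hc, hc, hij]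
  have hmeet : ∀ {S : Set (Projectivization C (Fin 3 → C))} {a b : C}, IsHermBlock R σ ε S →
      (∀ y z, ptAff y z ∈ S ↔ y = a * z + b ∧ y + σ z * z ∈ epsLine R ε) → ptInf C ∉ S →
      ∀ i, (S ∩ T i).Nonempty → a * c i + b + σ (c i) * c i ∈ epsLine R ε := by
    intro S a b hSb hS hiS i hne
    obtain ⟨P, hPS, hPT⟩ := hne
    obtain rfl | ⟨y, z, rfl⟩ := eq_ptInf_or_ptAff h (hSb.subset hPS)
    · exact (hiS hPS).elim
    · obtain ⟨rfl, -⟩ := (hc i _ _).1 hPT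
      obtain ⟨rfl, hmem⟩ := (hS _ _).1 hPS
      exact hmem
  obtain ⟨a, b, hab⟩ := IsHermBlock.exists_affine h hB hiB
  have hBc := fun i => hmeet hB hab hiB i (hBT i)
  obtain ⟨k, hpk⟩ := hpT
  obtain rfl | ⟨y₀, z₀, rfl⟩ := eq_ptInf_or_ptAff h ((hTb k).subset hpk)
  · exact (hp rfl).elim
  obtain ⟨rfl, hy₀⟩ := (hc k _ _).1 hpk
  have hs : y₀ - (a * c k + b) ∈ epsLine R ε := by
    convert sub_mem hy₀ (hBc k) using 1
    ring
  have hτ := isTranslation_shear h hs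
  set s := y₀ - (a * c k + b) with hsdef
  set τ := projPerm (shear 0 s 0) with hτdef
  have hB' : IsHermBlock R σ ε (τ '' B) := hτ.1.2.1 B hB
  have hB'aff : ∀ y z, ptAff y z ∈ τ '' B ↔
      y = a * z + (b + s) ∧ y + σ z * z ∈ epsLine R ε := by
    intro y z
    have hyz : ptAff y z = τ (ptAff (y - s) z) := by
      rw [hτdef, projPerm_shear_ptAff]
      congr 1 <;> ring
    rw [hyz, τ.injective.mem_set_image, hab,
      show y - s + σ z * z = y + σ z * z + -s by ring,
      AddSubgroup.add_mem_cancel_right _ (neg_mem hs), sub_eq_iff_eq_add, add_assoc]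
  have hiB' : ptInf C ∉ τ '' B := by
    rwa [← hτ.2.1, τ.injective.mem_set_image]
  refine ⟨τ '' B, ⟨hB', (hB'aff _ _).2 ⟨by rw [hsdef]; ring, hy₀⟩, ?_⟩, ?_, τ, hτ, rfl⟩
  · have hmem : ∀ i, ptAff (a * c i + (b + s)) (c i) ∈ τ '' B ∩ T i := by
      intro i
      have hE : a * c i + (b + s) + σ (c i) * c i ∈ epsLine R ε := by
        convert add_mem (hBc i) hs using 1
        ring
      exact ⟨(hB'aff _ _).2 ⟨rfl, hE⟩, (hc i _ _).2 ⟨rfl, hE⟩⟩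
    have hne : ∀ i j, i ≠ j → ptAff (a * c i + (b + s)) (c i) ≠
        ptAff (a * c j + (b + s)) (c j) :=
      fun i j hij h0 => hij (hcinj (ptAff_inj.1 h0).2)
    exact ⟨_, _, _, hmem 0, hmem 1, hmem 2, hne 0 1 (by decide), hne 0 2 (by decide),
      hne 1 2 (by decide)⟩
  · intro S hS hpS hm
    have hiS : ptInf C ∉ S := ptInf_notMem_of_meets h hS hcinj
      (fun i y z hyz => ((hc i y z).1 hyz).1) (fun i => (hTb i).subset) hm
    obtain ⟨a', b', hab'⟩ := IsHermBlock.exists_affine h hS hiS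
    have hST : ∀ i, (S ∩ T i).Nonempty := by
      obtain ⟨P, Q, W, hP, hQ, hW, -⟩ := hm
      rw [Fin.forall_fin_succ, Fin.forall_fin_two]
      exact ⟨⟨P, hP⟩, ⟨Q, hQ⟩, ⟨W, hW⟩⟩
    obtain rfl := h.slope_eq hcinj hBc fun i => hmeet hS hab' hiS i (hST i)
    have hb' : b' = b + s := by
      linear_combination -((hab' _ _).1 hpS).1 + hsdef
    refine IsHermBlock.ext h hS hB' (iff_of_false hiS hiB') fun y z => ?_
    rw [hab', hB'aff, hb']

end Coordinates

end GeneralizedHermitianUnital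

/-- Property (TRA) of the generalized hermitian unital `H(C|R)`. -/
theorem exists_unique_block_translate
    {C : Type*} [Field C] (R : Subfield C) (ε t d : C) (σ : C →+* C)
    (hrank : Module.finrank R C = 2)
    (hε : ε ∉ R) (ht : t ∈ R) (hd : d ∈ R)
    (hmin : ε ^ 2 - t * ε + d = 0)
    (hσR : ∀ r ∈ R, σ r = r) (hσε : σ ε = t - ε)
    (p : Projectivization C (Fin 3 → C)) (hp : p ∈ hermSet R σ ε)
    (X Y Z : Set (Projectivization C (Fin 3 → C)))
    (hX : IsHermBlock R σ ε X) (hY : IsHermBlock R σ ε Y) (hZ : IsHermBlock R σ ε Z)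
    (hXY : X ≠ Y) (hXZ : X ≠ Z) (hYZ : Y ≠ Z)
    (hpX : p ∈ X) (hpY : p ∈ Y) (hpZ : p ∈ Z)
    (B : Set (Projectivization C (Fin 3 → C))) (hB : IsHermBlock R σ ε B) (hpB : p ∉ B)
    (hBX : (B ∩ X).Nonempty) (hBY : (B ∩ Y).Nonempty) (hBZ : (B ∩ Z).Nonempty)
    (z : Projectivization C (Fin 3 → C)) (hzp : z ≠ p) (hzXYZ : z ∈ X ∪ Y ∪ Z) :
    ∃ B' : Set (Projectivization C (Fin 3 → C)),
      (IsHermBlock R σ ε B' ∧ z ∈ B' ∧ MeetsInThreeDistinctPoints B' X Y Z) ∧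
      (∀ B'', IsHermBlock R σ ε B'' → z ∈ B'' →
        MeetsInThreeDistinctPoints B'' X Y Z → B'' = B') ∧
      (∃ τ, IsTranslation (hermSet R σ ε) (IsHermBlock R σ ε) p τ ∧ τ '' B = B') ∧
      (∀ D, IsHermBlock R σ ε D → p ∈ D → (D ∩ (B ∪ B')).Nonempty →
        (D ∩ B).Nonempty ∧ (D ∩ B').Nonempty) := by
  have h : GeneralizedHermitianUnital.IsQuadratic R ε t d σ :=
    ⟨hrank, hε, ht, hd, hmin, hσR, hσε⟩
  obtain ⟨e, he, hep⟩ :=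
    GeneralizedHermitianUnital.exists_preservesIncidence_eq_ptInf h hp
  obtain ⟨B', hB', huniq, τ, hτ, rfl⟩ := GeneralizedHermitianUnital.UniqueTranslateAt.of_perm he
    (hep ▸ GeneralizedHermitianUnital.uniqueTranslateAt_ptInf h)
    X Y Z B hX hY hZ hXY hXZ hYZ hpX hpY hpZ hB hpB hBX hBY hBZ z hzp hzXYZ
  exact ⟨τ '' B, hB', huniq, ⟨τ, hτ, rfl⟩, fun D hD hpD hne =>
    IsTranslation.meets_both
      (fun S hS => IsHermBlock.subset hS) hτ hB hD hpD hne⟩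
end
end
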